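/- Under the standing assumptions, G has exponential growth, i.e. liminf_{n→∞} (1/n)·ln #B_S(n) > 0; moreover there exists λ > 1 such that for all sufficiently large n, #B_S(⌊0.9n⌋) / #B_S(n) ≤ λ^{−n}. -/

import Mathlib

namespace AcylCount

/-! ### Geodesic segments and Gromov hyperbolicity -/

/-- A finite geodesic segment in a metric space, parametrized by arclength on `[0, len]`,
oriented from `initial := toFun 0` to `terminal := toFun len`. -/
structure GeodesicSegment (X : Type*) [MetricSpace X] where
  len : ℝ
  len_nonneg : 0 ≤ len
  toFun : ℝ → X
  isom : ∀ s ∈ Set.Icc (0:ℝ) len, ∀ t ∈ Set.Icc (0:ℝ) len,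
    dist (toFun s) (toFun t) = |s - t|

namespace GeodesicSegment

variable {X : Type*} [MetricSpace X]

/-- The initial point of a geodesic segment. -/
def initial (γ : GeodesicSegment X) : X := γ.toFun 0

/-- The terminal point of a geodesic segment. -/
def terminal (γ : GeodesicSegment X) : X := γ.toFun γ.len

/-- The image (underlying set) of a geodesic segment. -/
def seg (γ : GeodesicSegment X) : Set X := γ.toFun '' Set.Icc 0 γ.len

/-- The translate of a geodesic segment by an isometry. -/
def translate (γ : GeodesicSegment X) (f : X → X) (hf : Isometry f) :
    GeodesicSegment X where
  len := γ.len
  len_nonneg := γ.len_nonneg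
  toFun := f ∘ γ.toFun
  isom := fun s hs t ht => by
    simp only [Function.comp_apply, hf.dist_eq]
    exact γ.isom s hs t ht

/-- The degenerate geodesic segment consisting of a single point. -/
def point (p : X) : GeodesicSegment X where
  len := 0
  len_nonneg := le_refl 0
  toFun := fun _ => p
  isom := fun s hs t ht => by
    have hs0 : s = 0 := le_antisymm hs.2 hs.1
    have ht0 : t = 0 := le_antisymm ht.2 ht.1
    simp [hs0, ht0]

/-- `η` is a subsegment of `γ`. -/
def IsSubsegment (η γ : GeodesicSegment X) : Prop :=
  ∃ a b : ℝ, 0 ≤ a ∧ a ≤ b ∧ b ≤ γ.len ∧ η.len = b - a ∧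
    ∀ t ∈ Set.Icc (0:ℝ) η.len, η.toFun t = γ.toFun (a + t)

/-- `p` occurs (weakly) before `q` along the oriented geodesic segment `γ`. -/
def Before (γ : GeodesicSegment X) (p q : X) : Prop :=
  ∃ s t : ℝ, s ∈ Set.Icc (0:ℝ) γ.len ∧ t ∈ Set.Icc (0:ℝ) γ.len ∧ s ≤ t ∧
    γ.toFun s = p ∧ γ.toFun t = q

end GeodesicSegment

/-- A geodesic metric space: every two points are joined by a geodesic segment. -/
def IsGeodesicSpace (X : Type*) [MetricSpace X] : Prop :=
  ∀ x y : X, ∃ γ : GeodesicSegment X, γ.initial = x ∧ γ.terminal = y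

/-- δ-hyperbolicity via slim triangles: each side of a geodesic triangle lies in the
closed δ-neighborhood of the union of the other two sides. -/
def IsDeltaHyperbolic (X : Type*) [MetricSpace X] (δ : ℝ) : Prop :=
  ∀ γ₁ γ₂ γ₃ : GeodesicSegment X,
    γ₁.initial = γ₃.initial → γ₁.terminal = γ₂.initial → γ₂.terminal = γ₃.terminal →
    γ₃.seg ⊆ Metric.cthickening δ (γ₁.seg ∪ γ₂.seg)

variable {X : Type*} [MetricSpace X]

/-- The closest point projection of `x` to (the image of) the geodesic `γ`. -/
def proj (γ : GeodesicSegment X) (x : X) : Set X :=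
  {p | p ∈ γ.seg ∧ dist x p = Metric.infDist x γ.seg}

/-- The closest point projection of a set `A` to the geodesic `γ`. -/
def projSet (γ : GeodesicSegment X) (A : Set X) : Set X :=
  ⋃ a ∈ A, proj γ a

/-- The ordered pair of oriented geodesic segments `(γ, η)` is `K`-aligned. -/
def AlignedPair (K : ℝ) (γ η : GeodesicSegment X) : Prop :=
  Metric.diam (projSet γ η.seg ∪ {γ.terminal}) < K ∧
  Metric.diam (projSet η γ.seg ∪ {η.initial}) < K

/-- A sequence of oriented geodesic segments is `K`-aligned if each consecutive
pair is `K`-aligned. -/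
def AlignedSeq (K : ℝ) (l : List (GeodesicSegment X)) : Prop :=
  l.Chain' (AlignedPair K)

/-- The Gromov product `(y, z)_x`. -/
noncomputable def gromovProd (x y z : X) : ℝ := (dist y x + dist x z - dist y z) / 2

/-! ### Word metric -/

variable {G : Type*} [Group G]

/-- The word length of `g` with respect to the (symmetrized) generating set `S`. -/
noncomputable def wordLength (S : Finset G) (g : G) : ℕ :=
  sInf {n | ∃ l : List G, l.length = n ∧ (∀ x ∈ l, x ∈ S ∨ x⁻¹ ∈ S) ∧ l.prod = g}

/-- The word metric on `G` with respect to `S`. -/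
noncomputable def wordDist (S : Finset G) (g h : G) : ℕ := wordLength S (g⁻¹ * h)

/-- The ball of radius `r` in the word metric, centered at the identity. -/
def ball (S : Finset G) (r : ℝ) : Set G := {g | (wordLength S g : ℝ) ≤ r}

/-- `G` has no cyclic subgroup of finite index. -/
def NonVirtuallyCyclic (G : Type*) [Group G] : Prop :=
  ¬ ∃ H : Subgroup G, H.FiniteIndex ∧ IsCyclic H

/-! ### Isometric actions, loxodromics, WPD -/

/-- `g` is a loxodromic isometry for the action `ρ` with basepoint `x0`: the asymptotic
translation length `τ_X(g) = lim dist x0 (g^n x0) / n` exists and is positive. -/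
def IsLoxodromic (ρ : G → X → X) (x0 : X) (g : G) : Prop :=
  ∃ τ : ℝ, 0 < τ ∧
    Filter.Tendsto (fun n : ℕ => dist x0 (ρ (g ^ n) x0) / n) Filter.atTop (nhds τ)

/-- The WPD (weak proper discontinuity) property of `g` for the action `ρ` with
basepoint `x0`. -/
def HasWPD (ρ : G → X → X) (x0 : X) (g : G) : Prop :=
  ∀ K : ℝ, 0 < K → ∃ N M : ℕ,
    {h : G | dist x0 (ρ h x0) < K ∧ dist (ρ (g ^ N) x0) (ρ h (ρ (g ^ N) x0)) < K}.Finite ∧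
    {h : G | dist x0 (ρ h x0) < K ∧ dist (ρ (g ^ N) x0) (ρ h (ρ (g ^ N) x0)) < K}.ncard < M

/-- The list of translated geodesics `h 1 • Υ, …, h m • Υ`. -/
def transList (ρ : G → X → X) (hisom : ∀ g : G, Isometry (ρ g))
    (Υ : GeodesicSegment X) (h : ℕ → G) (m : ℕ) : List (GeodesicSegment X) :=
  (List.range m).map fun i => Υ.translate (ρ (h (i + 1))) (hisom _)

/-- The specification of the constant `E₀` from Fact 2.7 (Bestvina–Fujiwara):
(i) Gromov product bounds, (ii) the WPD-type conclusion for large projections. -/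
def E0Spec (S : Finset G) (ρ : G → X → X) (x0 : X) (φ : G) (E0 : ℝ) : Prop :=
  0 < E0 ∧
  (∀ g : G, ∃ s t : G, (s ∈ S ∨ s = 1) ∧ (t ∈ S ∨ t = 1) ∧
    (∀ i : ℤ, 0 < i → gromovProd x0 (ρ (φ ^ i) x0) (ρ (s * g) x0) ≤ E0) ∧
    (∀ j : ℤ, j < 0 → gromovProd x0 (ρ (φ ^ j) x0) (ρ (t * g) x0) ≤ E0)) ∧
  (∀ n : ℕ, 0 < n → ∀ g : G, ∀ γ : GeodesicSegment X,
    γ.initial = x0 → γ.terminal = ρ (φ ^ n) x0 →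
    ∀ p ∈ proj γ (ρ g x0), ∀ q ∈ proj γ (ρ (g * φ ^ n) x0),
      γ.Before p q → E0 < dist p q →
      ∃ i j : ℕ, i ≤ n ∧ j ≤ n ∧ (wordDist S (φ ^ i) (g * φ ^ j) : ℝ) < E0)

/-- The set `V_{L,ε}(n)`. Here `Υ` is the chosen geodesic `Υ_L = [x₀, φ^L x₀]`. -/
def Vset (S : Finset G) (ρ : G → X → X) (hisom : ∀ g : G, Isometry (ρ g)) (x0 : X)
    (δ E0 : ℝ) (Υ : GeodesicSegment X) (ε : ℝ) (n : ℕ) : Set G :=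
  {g | g ∈ ball S (n:ℝ) ∧ ∃ h : ℕ → G,
    AlignedSeq (6 * E0 + 300 * δ)
      ([GeodesicSegment.point x0] ++ transList ρ hisom Υ h ⌈ε * (n:ℝ)⌉₊ ++
        [GeodesicSegment.point (ρ g x0)])}

/-- The set `W_{L,ε}(n)`. Here `Υ` is the chosen geodesic `Υ_L = [x₀, φ^L x₀]`. -/
def Wset (S : Finset G) (ρ : G → X → X) (hisom : ∀ g : G, Isometry (ρ g)) (x0 : X)
    (δ E0 : ℝ) (Υ : GeodesicSegment X) (ε : ℝ) (n : ℕ) : Set G :=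
  {g | g ∈ ball S (n:ℝ) ∧ ∃ h : ℕ → G,
    AlignedSeq (6 * E0 + 360 * δ)
      ([GeodesicSegment.point x0] ++ transList ρ hisom Υ h ⌈ε * (n:ℝ)⌉₊ ++
        [GeodesicSegment.point (ρ g x0)]) ∧
    AlignedPair (6 * E0 + 360 * δ) (GeodesicSegment.point (ρ g⁻¹ x0))
      (Υ.translate (ρ (h 1)) (hisom _)) ∧
    AlignedPair (6 * E0 + 360 * δ) (Υ.translate (ρ (h ⌈ε * (n:ℝ)⌉₊)) (hisom _))
      (GeodesicSegment.point (ρ (g ^ 2) x0))}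

/-- The set `BAD_{L,ε}(n)`. -/
def BADset (S : Finset G) (ρ : G → X → X) (hisom : ∀ g : G, Isometry (ρ g)) (x0 : X)
    (δ E0 : ℝ) (Υ : GeodesicSegment X) (ε : ℝ) (n : ℕ) : Set G :=
  ball S (n:ℝ) \ (ball S ((⌊(0.9:ℝ) * (n:ℝ)⌋₊ : ℕ) : ℝ) ∪ Vset S ρ hisom x0 δ E0 Υ ε n)

/-! ### Paths in the word metric -/

/-- `P` is a `d_S`-path connecting `a` to `b`. -/
noncomputable def IsPathFrom (S : Finset G) (P : List G) (a b : G) : Prop :=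
  P ≠ [] ∧ P.Chain' (fun u v => wordDist S u v = 1) ∧ P.head? = some a ∧ P.getLast? = some b

/-- The distance `d_S(P, g)` from a path `P` to a group element `g`. -/
noncomputable def pathDist (S : Finset G) (P : List G) (g : G) : ℕ :=
  sInf {d | ∃ v ∈ P, d = wordDist S v g}


/-! ### Hyperbolic length functions -/

/-- The Gromov product of `g` and `h` based at `1`, for the left-invariant pseudometric
`(g, h) ↦ L (g⁻¹ * h)` on a group. -/
noncomputable def lengthProd (L : G → ℝ) (g h : G) : ℝ := (L g + L h - L (g⁻¹ * h)) / 2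

/-- `L` is a length function on `G` satisfying Gromov's four-point inequality with constant `D`. -/
structure IsHypLength (L : G → ℝ) (D : ℝ) : Prop where
  one : L 1 = 0
  inv : ∀ g, L g⁻¹ = L g
  mul_le : ∀ g h, L (g * h) ≤ L g + L h
  four_point : ∀ g h k,
    min (lengthProd L g h) (lengthProd L h k) ≤ lengthProd L g k + D

namespace IsHypLength

variable {L : G → ℝ} {D : ℝ}

theorem nonneg (hL : IsHypLength L D) (g : G) : 0 ≤ L g := by
  have h := hL.mul_le g g⁻¹
  rw [mul_inv_cancel, hL.one, hL.inv] at h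
  linarith

theorem inv_mul_comm (hL : IsHypLength L D) (g h : G) : L (g⁻¹ * h) = L (h⁻¹ * g) := by
  rw [← hL.inv]
  simp

theorem prod_comm (hL : IsHypLength L D) (g h : G) :
    lengthProd L g h = lengthProd L h g := by
  rw [lengthProd, lengthProd, hL.inv_mul_comm g h]
  ring

theorem prod_one_left (hL : IsHypLength L D) (g : G) : lengthProd L 1 g = 0 := by
  simp [lengthProd, hL.one]

theorem prod_nonneg (hL : IsHypLength L D) (g h : G) : 0 ≤ lengthProd L g h := by
  have h₁ := hL.mul_le g⁻¹ h
  rw [hL.inv] at h₁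
  unfold lengthProd
  linarith

theorem prod_le_left (hL : IsHypLength L D) (g h : G) : lengthProd L g h ≤ L g := by
  have h₁ := hL.mul_le g (g⁻¹ * h)
  rw [mul_inv_cancel_left] at h₁
  unfold lengthProd
  linarith

theorem const_nonneg (hL : IsHypLength L D) : 0 ≤ D := by
  have h := hL.four_point 1 1 1
  rw [hL.prod_one_left] at h
  simpa using h

/-- Exchanging the basepoint with the first point. -/
theorem prod_mul_self (hL : IsHypLength L D) (g h : G) :
    lengthProd L g (g * h) = L g - lengthProd L g⁻¹ h := by
  simp only [lengthProd, inv_mul_cancel_left, hL.inv, inv_inv]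
  ring

theorem length_pow_le (hL : IsHypLength L D) (g : G) (n : ℕ) : L (g ^ n) ≤ n * L g := by
  induction n with
  | zero => simp [hL.one]
  | succ n ih =>
    rw [pow_succ]
    push_cast
    linarith [hL.mul_le (g ^ n) g]

theorem length_le_mul_left (hL : IsHypLength L D) (g h : G) : L h ≤ L (g * h) + L g := by
  have h₁ := hL.mul_le g⁻¹ (g * h)
  rw [inv_mul_cancel_left, hL.inv] at h₁
  linarith

theorem prod_mul_le (hL : IsHypLength L D) (g s h : G) :
    lengthProd L (g * s) h ≤ lengthProd L g h + L s := by
  have h₁ := hL.mul_le g s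
  have h₂ := hL.mul_le s ((g * s)⁻¹ * h)
  have h₃ : s * ((g * s)⁻¹ * h) = g⁻¹ * h := by group
  rw [h₃] at h₂
  unfold lengthProd
  linarith

theorem prod_translate_le (hL : IsHypLength L D) (k g h : G) :
    lengthProd L (k * g) (k * h) ≤ lengthProd L g h + L k := by
  have h₁ := hL.mul_le k g
  have h₂ := hL.mul_le k h
  have h₃ : (k * g)⁻¹ * (k * h) = g⁻¹ * h := by group
  unfold lengthProd
  rw [h₃]
  linarith

theorem le_prod_translate (hL : IsHypLength L D) (k g h : G) :
    lengthProd L g h ≤ lengthProd L (k * g) (k * h) + L k := by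
  have h₁ := hL.prod_translate_le k⁻¹ (k * g) (k * h)
  rwa [inv_mul_cancel_left, inv_mul_cancel_left, hL.inv] at h₁

theorem four_point_of_lt (hL : IsHypLength L D) {g h k : G} {c : ℝ}
    (h₁ : c + D < lengthProd L g h) (h₂ : lengthProd L g k ≤ c) :
    lengthProd L h k ≤ c + D := by
  by_contra! h₃
  have := hL.four_point g h k
  have := lt_min h₁ h₃
  linarith

/-- Products of elements with long lengths and small backtracking stay transverse to the
inverses of these elements. -/
theorem prod_inv_list_le (hL : IsHypLength L D) {A : Set G} {c : ℝ} (hc : 0 ≤ c)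
    (hA : ∀ u ∈ A, ∀ v ∈ A, lengthProd L u⁻¹ v ≤ c) (hlen : ∀ u ∈ A, 2 * c + 2 * D < L u)
    (l : List G) (hl : ∀ x ∈ l, x ∈ A) {u : G} (hu : u ∈ A) :
    lengthProd L u⁻¹ l.prod ≤ c + D := by
  induction l generalizing u with
  | nil =>
    rw [List.prod_nil, hL.prod_comm, hL.prod_one_left]
    linarith [hL.const_nonneg]
  | cons v l ih =>
    have hv : v ∈ A := hl v (by simp)
    have h₁ := ih (fun x hx => hl x (by simp [hx])) hv
    have h₂ := hL.prod_mul_self v l.prod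
    rw [List.prod_cons, hL.prod_comm]
    refine hL.four_point_of_lt (g := v) ?_ ?_
    · linarith [hlen v hv]
    · rw [hL.prod_comm]
      exact hA u hu v hv

/-- Two elements satisfying the ping-pong inequalities generate a free semigroup. -/
theorem injective_words (hL : IsHypLength L D) {f : Bool → G} {c : ℝ} (hc : 0 ≤ c)
    (hA : ∀ u v, lengthProd L (f u)⁻¹ (f v) ≤ c) (hab : lengthProd L (f true) (f false) ≤ c)
    (hlen : ∀ u, 2 * c + 2 * D < L (f u)) :
    ∀ l l' : List Bool, l.length = l'.length →
      (l.map f).prod = (l'.map f).prod → l = l' := by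
  have key : ∀ (u : Bool) (l : List Bool),
      c + D < lengthProd L (f u) (f u * (l.map f).prod) := by
    intro u l
    have h₁ := hL.prod_inv_list_le (A := Set.range f) hc
      (by rintro _ ⟨u, rfl⟩ _ ⟨v, rfl⟩; exact hA u v) (by rintro _ ⟨u, rfl⟩; exact hlen u)
      (l.map f) (fun x hx => by obtain ⟨b, -, rfl⟩ := List.mem_map.mp hx; exact ⟨b, rfl⟩)
      (Set.mem_range_self u)
    rw [hL.prod_mul_self]
    linarith [hlen u]
  have ne : ∀ l l' : List Bool, f true * (l.map f).prod ≠ f false * (l'.map f).prod := by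
    intro l l' h
    have h₁ := key true l
    have h₂ := key false l'
    rw [← h, hL.prod_comm] at h₂
    linarith [hL.four_point_of_lt h₁ hab]
  intro l
  induction l with
  | nil =>
    intro l' h _
    exact (List.length_eq_zero_iff.mp h.symm).symm
  | cons u l ih =>
    rintro (_ | ⟨v, l'⟩) h h'
    · simp at h
    · simp only [List.map_cons, List.prod_cons, List.length_cons, add_left_inj] at h h'
      have huv : u = v := by
        cases u <;> cases v
        · rfl
        · exact absurd h'.symm (ne l' l)
        · exact absurd h' (ne l l')
        · rfl
      subst huv
      rw [ih l' h (mul_left_cancel h')]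

theorem exists_pow_prod_le_of_lt (hL : IsHypLength L D) {ψ : G}
    (hψ : 2 * lengthProd L ψ⁻¹ ψ + 3 * D < L ψ) (m n : ℕ) :
    lengthProd L (ψ⁻¹ ^ m) (ψ ^ n) ≤ lengthProd L ψ⁻¹ ψ + 2 * D := by
  have hD := hL.const_nonneg
  have hc := hL.prod_nonneg ψ⁻¹ ψ
  set c := lengthProd L ψ⁻¹ ψ with hcdef
  have key : ∀ x : G, lengthProd L x⁻¹ x ≤ c → 2 * c + 2 * D < L x → ∀ k : ℕ,
      lengthProd L x⁻¹ (x ^ k) ≤ c + D := by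
    intro x h₁ h₂ k
    have := hL.prod_inv_list_le (A := {x}) hc (by simpa using h₁) (by simpa using h₂)
      (List.replicate k x) (fun y hy => List.eq_of_mem_replicate hy) (Set.mem_singleton x)
    rwa [List.prod_replicate] at this
  have h₁ := key ψ le_rfl (by linarith) n
  cases m with
  | zero =>
    rw [pow_zero, hL.prod_one_left]
    linarith
  | succ m =>
    have h₂ := key ψ⁻¹ (by rw [inv_inv, hL.prod_comm]) (by rw [hL.inv]; linarith) m
    have h₃ := hL.prod_mul_self ψ⁻¹ (ψ⁻¹ ^ m)
    rw [hL.inv] at h₃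
    rw [pow_succ']
    have := hL.four_point_of_lt (g := ψ⁻¹) (h := ψ⁻¹ * ψ⁻¹ ^ m) (k := ψ ^ n) (c := c + D)
      (by linarith) h₁
    linarith

/-- The orbit of a loxodromic element does not backtrack: it is a quasi-geodesic. -/
theorem exists_pow_prod_le (hL : IsHypLength L D) {φ : G} {τ : ℝ} (hτ : 0 < τ)
    (hlim : Filter.Tendsto (fun n : ℕ => L (φ ^ n) / n) Filter.atTop (nhds τ)) :
    ∃ C : ℝ, ∀ m n : ℕ, lengthProd L (φ⁻¹ ^ m) (φ ^ n) ≤ C := by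
  obtain ⟨N₀, hN₀⟩ := Filter.eventually_atTop.mp
    (hlim.eventually (Ioo_mem_nhds (show τ - τ / 10 < τ by linarith)
      (show τ < τ + τ / 10 by linarith)))
  obtain ⟨N₁, hN₁⟩ := exists_nat_gt (6 * D / τ)
  set N := max (max N₀ N₁) 1 with hN
  have hNpos : (0 : ℝ) < N := by
    have : 1 ≤ N := le_max_right _ _
    exact_mod_cast this
  have hN₀N : N₀ ≤ N := (le_max_left _ _).trans (le_max_left _ _)
  have hN₁N : (N₁ : ℝ) ≤ N := by
    exact_mod_cast (le_max_right N₀ N₁).trans (le_max_left _ 1)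
  have h₁ := (hN₀ N hN₀N).2
  have h₂ := (hN₀ (2 * N) (by omega)).1
  rw [div_lt_iff₀ hNpos] at h₁
  rw [lt_div_iff₀ (by push_cast; linarith)] at h₂
  push_cast at h₂
  have h₃ : 6 * D < τ * N := by
    rw [div_lt_iff₀ hτ] at hN₁
    nlinarith
  have h₄ : 2 * lengthProd L (φ ^ N)⁻¹ (φ ^ N) + 3 * D < L (φ ^ N) := by
    have : (φ ^ N)⁻¹⁻¹ * φ ^ N = φ ^ (2 * N) := by rw [inv_inv, ← pow_add, two_mul]
    rw [lengthProd, this, hL.inv]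
    linarith [hL.const_nonneg]
  have key := hL.exists_pow_prod_le_of_lt h₄
  refine ⟨lengthProd L (φ ^ N)⁻¹ (φ ^ N) + 2 * D + N * L φ + N * L φ, fun m n => ?_⟩
  have split : ∀ (x : G) (k : ℕ), x ^ k = (x ^ N) ^ (k / N) * x ^ (k % N) := by
    intro x k
    rw [← pow_mul, ← pow_add, Nat.div_add_mod]
  have hrem : ∀ k : ℕ, L (φ ^ (k % N)) ≤ N * L φ := by
    intro k
    refine (hL.length_pow_le φ _).trans (mul_le_mul_of_nonneg_right ?_ (hL.nonneg φ))
    exact_mod_cast (Nat.mod_lt k (by omega)).le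
  rw [split φ⁻¹ m, split φ n]
  have h₅ := hL.prod_mul_le ((φ⁻¹ ^ N) ^ (m / N)) (φ⁻¹ ^ (m % N))
    ((φ ^ N) ^ (n / N) * φ ^ (n % N))
  have h₆ := hL.prod_mul_le ((φ ^ N) ^ (n / N)) (φ ^ (n % N)) ((φ⁻¹ ^ N) ^ (m / N))
  rw [hL.prod_comm _ ((φ⁻¹ ^ N) ^ (m / N)), hL.prod_comm _ ((φ⁻¹ ^ N) ^ (m / N))] at h₆
  have h₇ := key (m / N) (n / N)
  rw [inv_pow φ (m % N), hL.inv] at h₅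
  rw [← inv_pow φ N] at h₇ ⊢
  rw [inv_pow φ (m % N)]
  linarith [hrem m, hrem n]

/-- A point that is nearly between the endpoints of a quasi-geodesic path is close to the path. -/
theorem exists_near_path (hL : IsHypLength L D) {p : ℕ → G} {n : ℕ} {g : G} {s B C : ℝ}
    (hs : ∀ k, L ((p k)⁻¹ * p (k + 1)) ≤ s)
    (hp : ∀ k ≤ n, lengthProd L ((p k)⁻¹ * p 0) ((p k)⁻¹ * p n) ≤ C)
    (hg : lengthProd L (g⁻¹ * p 0) (g⁻¹ * p n) ≤ B) :
    ∃ k ≤ n, L ((p k)⁻¹ * g) ≤ 2 * (C + D + s) + B := by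
  have hs₀ : 0 ≤ s := (hL.nonneg _).trans (hs 0)
  have hC : 0 ≤ C := (hL.prod_nonneg _ _).trans (hp 0 n.zero_le)
  have hD := hL.const_nonneg
  have key : ∃ k ≤ n, lengthProd L ((p k)⁻¹ * p 0) ((p k)⁻¹ * g) ≤ C + D + s ∧
      lengthProd L ((p k)⁻¹ * g) ((p k)⁻¹ * p n) ≤ C + D + s := by
    by_contra! hcon
    have all : ∀ k ≤ n, lengthProd L ((p k)⁻¹ * p 0) ((p k)⁻¹ * g) ≤ C + D := by
      intro k
      induction k with
      | zero =>
        intro _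
        rw [inv_mul_cancel, hL.prod_one_left]
        linarith
      | succ k ih =>
        intro hk
        have h₁ := hcon k (by omega) (by linarith [ih (by omega)])
        have h₂ := hL.le_prod_translate ((p (k + 1))⁻¹ * p k)
          ((p k)⁻¹ * g) ((p k)⁻¹ * p n)
        simp only [mul_assoc, mul_inv_cancel_left] at h₂
        rw [hL.inv_mul_comm] at h₂
        have h₃ := hs k
        have h₄ := hp (k + 1) hk
        rw [hL.prod_comm] at h₄ ⊢
        exact hL.four_point_of_lt (g := (p (k + 1))⁻¹ * p n)
          (by rw [hL.prod_comm]; linarith) h₄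
    have h₁ := hcon n le_rfl (by linarith [all n le_rfl])
    rw [inv_mul_cancel, hL.prod_comm, hL.prod_one_left] at h₁
    linarith
  obtain ⟨k, hk, h₁, h₂⟩ := key
  refine ⟨k, hk, ?_⟩
  have h₃ := hL.prod_nonneg ((p k)⁻¹ * p 0) ((p k)⁻¹ * p n)
  have e : ∀ x y z : G, (x⁻¹ * y)⁻¹ * (x⁻¹ * z) = y⁻¹ * z := by intro x y z; group
  simp only [lengthProd, e] at h₁ h₂ h₃ hg
  rw [hL.inv_mul_comm g (p 0)] at hg
  linarith

theorem length_sub_le_prod_pow (hL : IsHypLength L D) {x : G} {C : ℝ}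
    (hx : ∀ m n : ℕ, lengthProd L (x⁻¹ ^ m) (x ^ n) ≤ C) {m n : ℕ} (h : m ≤ n) :
    L (x ^ m) - C ≤ lengthProd L (x ^ m) (x ^ n) := by
  obtain ⟨k, rfl⟩ := Nat.exists_eq_add_of_le h
  rw [pow_add, hL.prod_mul_self, ← inv_pow]
  linarith [hx m k]

/-- Elements that translate a long power `x ^ n` away from the axis of `x` give ping-pong pairs. -/
theorem exists_injective_words (hL : IsHypLength L D) {x g : G} {C R : ℝ}
    (hx : ∀ m n : ℕ, lengthProd L (x⁻¹ ^ m) (x ^ n) ≤ C)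
    (htop : Filter.Tendsto (fun n : ℕ => L (x ^ n)) Filter.atTop Filter.atTop)
    (h₁ : ∀ n : ℕ, lengthProd L (x ^ n) (g * x ^ n) ≤ R)
    (h₂ : ∀ n : ℕ, lengthProd L (x⁻¹ ^ n) (g * x ^ n) ≤ R) :
    ∃ f : Bool → G, ∀ l l' : List Bool, l.length = l'.length →
      (l.map f).prod = (l'.map f).prod → l = l' := by
  have hC : 0 ≤ C := (hL.prod_nonneg _ _).trans (hx 0 0)
  have hR : 0 ≤ R := (hL.prod_nonneg _ _).trans (h₁ 0)
  have hg := hL.nonneg g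
  set c := R + C + L g with hc
  obtain ⟨n, hn⟩ := (htop.eventually_gt_atTop (2 * c + 2 * D + L g)).exists
  have h₃ := hL.prod_mul_le (x⁻¹ ^ n) g⁻¹ (x ^ n)
  have h₄ := hL.prod_mul_le (x⁻¹ ^ n) g⁻¹ (g * x ^ n)
  have h₅ : L (x ^ n) ≤ L (g * x ^ n) + L g := hL.length_le_mul_left _ _
  rw [hL.inv] at h₃ h₄
  have h₆ := hx n n
  have h₇ := h₁ n
  have h₈ := h₂ n
  refine ⟨fun b => if b then x ^ n else g * x ^ n, hL.injective_words (c := c) (by linarith)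
    ?_ ?_ ?_⟩
  · rintro (_ | _) (_ | _)
    · simp only [Bool.false_eq_true, if_false, mul_inv_rev, ← inv_pow]
      linarith
    · simp only [Bool.false_eq_true, if_false, if_true, mul_inv_rev, ← inv_pow]
      linarith
    · simp only [Bool.false_eq_true, if_false, if_true, ← inv_pow]
      linarith
    · simp only [if_true, ← inv_pow]
      linarith
  · simp only [Bool.false_eq_true, if_false, if_true]
    linarith
  · rintro (_ | _)
    · simp only [Bool.false_eq_true, if_false]
      linarith
    · simp only [if_true]
      linarith

/-- If `g` coarsely preserves the pair of ends of `φ`, then `g` is close to the axis of `φ`. -/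
theorem exists_zpow_near (hL : IsHypLength L D) {φ : G} {C : ℝ}
    (hφ : ∀ m n : ℕ, lengthProd L (φ⁻¹ ^ m) (φ ^ n) ≤ C) (g : G)
    (hpos : ∀ R : ℝ, ∃ y, (y = φ ∨ y = φ⁻¹) ∧ ∃ n : ℕ, R < lengthProd L (y ^ n) (g * φ ^ n))
    (hneg : ∀ R : ℝ, ∃ y, (y = φ ∨ y = φ⁻¹) ∧ ∃ n : ℕ, R < lengthProd L (y ^ n) (g * φ⁻¹ ^ n)) :
    ∃ k ∈ Subgroup.zpowers φ, L (k⁻¹ * g) ≤ 2 * (C + D + L φ) + (C + 2 * D) := by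
  have hC : 0 ≤ C := (hL.prod_nonneg _ _).trans (hφ 0 0)
  have hD := hL.const_nonneg
  have hg := hL.nonneg g
  set R := L g + 2 * C + 3 * D with hR
  obtain ⟨y, hy, n, hn⟩ := hpos R
  obtain ⟨z, hz, m, hm⟩ := hneg R
  have hax : ∀ m n : ℕ, lengthProd L (y⁻¹ ^ m) (y ^ n) ≤ C := by
    rcases hy with rfl | rfl
    · exact hφ
    · intro i j
      rw [hL.prod_comm, inv_inv]
      exact hφ j i
  have hyφ : L y = L φ := by rcases hy with rfl | rfl <;> simp [hL.inv]
  have hymem : y ∈ Subgroup.zpowers φ := by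
    rcases hy with rfl | rfl
    · exact Subgroup.mem_zpowers _
    · exact inv_mem (Subgroup.mem_zpowers _)
  have hgg : lengthProd L (g * φ ^ n) (g * φ⁻¹ ^ m) ≤ C + L g := by
    rw [hL.prod_comm]
    exact (hL.prod_translate_le g _ _).trans (by linarith [hφ m n])
  have hne : z ≠ y := by
    rintro rfl
    have h₁ : R - C < lengthProd L (z ^ n) (z ^ m) := by
      rcases le_total n m with h | h
      · have := hL.length_sub_le_prod_pow hax h
        linarith [hL.prod_le_left (z ^ n) (g * φ ^ n)]
      · have := hL.length_sub_le_prod_pow hax h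
        rw [hL.prod_comm]
        linarith [hL.prod_le_left (z ^ m) (g * φ⁻¹ ^ m)]
    have h₂ := hL.four_point_of_lt (g := g * φ ^ n) (h := z ^ n) (k := g * φ⁻¹ ^ m)
      (by rw [hL.prod_comm]; linarith) hgg
    have h₃ := hL.four_point_of_lt (g := g * φ⁻¹ ^ m) (h := z ^ m) (k := z ^ n)
      (c := C + L g + D) (by rw [hL.prod_comm]; linarith) (by rw [hL.prod_comm]; exact h₂)
    rw [hL.prod_comm] at h₃
    linarith
  have hzy : z = y⁻¹ := by
    rcases hy with rfl | rfl <;> rcases hz with rfl | rfl <;> simp_all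
  subst hzy
  have hbetween : lengthProd L (g⁻¹ * y⁻¹ ^ m) (g⁻¹ * y ^ n) ≤ C + 2 * D := by
    have h₁ := hL.le_prod_translate g⁻¹ (y ^ n) (g * φ ^ n)
    have h₂ := hL.le_prod_translate g⁻¹ (y⁻¹ ^ m) (g * φ⁻¹ ^ m)
    rw [inv_mul_cancel_left, hL.inv] at h₁ h₂
    have h₃ := hL.four_point_of_lt (g := φ ^ n) (h := g⁻¹ * y ^ n) (k := φ⁻¹ ^ m) (c := C)
      (by rw [hL.prod_comm]; linarith) (by rw [hL.prod_comm]; exact hφ m n)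
    have h₄ := hL.four_point_of_lt (g := φ⁻¹ ^ m) (h := g⁻¹ * y⁻¹ ^ m) (k := g⁻¹ * y ^ n)
      (c := C + D) (by rw [hL.prod_comm]; linarith) (by rw [hL.prod_comm]; exact h₃)
    linarith
  have hnear : ∃ k ≤ m + n, L ((y⁻¹ ^ m * y ^ k)⁻¹ * g) ≤ 2 * (C + D + L φ) + (C + 2 * D) := by
    refine hL.exists_near_path (p := fun k => y⁻¹ ^ m * y ^ k) (fun k => ?_) (fun k hk => ?_) ?_
    · have : (y⁻¹ ^ m * y ^ k)⁻¹ * (y⁻¹ ^ m * y ^ (k + 1)) = y := by group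
      simp only [this, hyφ, le_refl]
    · obtain ⟨j, hj⟩ := Nat.exists_eq_add_of_le hk
      have e₁ : (y⁻¹ ^ m * y ^ k)⁻¹ * (y⁻¹ ^ m * y ^ 0) = y⁻¹ ^ k := by group
      have e₂ : (y⁻¹ ^ m * y ^ k)⁻¹ * (y⁻¹ ^ m * y ^ (m + n)) = y ^ j := by
        rw [hj]
        group
      simp only [e₁, e₂]
      exact hax k j
    · have e : y⁻¹ ^ m * y ^ (m + n) = y ^ n := by group
      simpa only [e, pow_zero, mul_one] using hbetween
  obtain ⟨k, -, hk⟩ := hnear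
  exact ⟨y⁻¹ ^ m * y ^ k, mul_mem (pow_mem (inv_mem hymem) _) (pow_mem hymem _), hk⟩

/-- An element of bounded length preserving the positive end of `φ` up to sign coarsely
maps `φ ^ N` to `φ ^ N` or to `φ⁻¹ ^ N`, with error independent of `N`. -/
theorem exists_length_conj_pow_le (hL : IsHypLength L D) {φ : G} {C B : ℝ}
    (hφ : ∀ m n : ℕ, lengthProd L (φ⁻¹ ^ m) (φ ^ n) ≤ C) {h : G} (hB : L h ≤ B)
    (hpos : ∀ R : ℝ, ∃ y, (y = φ ∨ y = φ⁻¹) ∧ ∃ n : ℕ, R < lengthProd L (y ^ n) (h * φ ^ n))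
    (N : ℕ) :
    ∃ y, (y = φ ∨ y = φ⁻¹) ∧ L ((y ^ N)⁻¹ * (h * φ ^ N)) ≤ 3 * B + 2 * C + 4 * D := by
  have hD := hL.const_nonneg
  have hC : 0 ≤ C := (hL.prod_nonneg _ _).trans (hφ 0 0)
  have hh := hL.nonneg h
  obtain ⟨y, hy, n, hn⟩ := hpos (N * L φ)
  have hax : ∀ m n : ℕ, lengthProd L (y⁻¹ ^ m) (y ^ n) ≤ C := by
    rcases hy with rfl | rfl
    · exact hφ
    · intro i j
      rw [hL.prod_comm, inv_inv]
      exact hφ j i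
  have hlen : ∀ k : ℕ, L (y ^ k) = L (φ ^ k) := by
    rcases hy with rfl | rfl
    · simp
    · intro k
      rw [inv_pow, hL.inv]
  refine ⟨y, hy, ?_⟩
  have hNn : N ≤ n := by
    by_contra! hlt
    have h₁ := hL.prod_le_left (y ^ n) (h * φ ^ n)
    rw [hlen] at h₁
    have h₂ := hL.length_pow_le φ n
    have h₃ : (n : ℝ) * L φ ≤ N * L φ :=
      mul_le_mul_of_nonneg_right (by exact_mod_cast hlt.le) (hL.nonneg φ)
    linarith
  have h₁ := hL.length_sub_le_prod_pow hax hNn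
  have h₂ := hL.length_sub_le_prod_pow hφ hNn
  have h₃ := hL.le_prod_translate h (φ ^ N) (φ ^ n)
  have h₄ := hL.length_pow_le φ N
  have h₅ := hL.four_point (y ^ n) (h * φ ^ n) (h * φ ^ N)
  have h₆ := hL.four_point (y ^ N) (y ^ n) (h * φ ^ N)
  have h₇ := hL.mul_le h (φ ^ N)
  rw [hL.prod_comm (h * φ ^ n)] at h₅
  rw [hlen] at h₁
  have h₈ : L (φ ^ N) - C - B - D ≤ lengthProd L (y ^ n) (h * φ ^ N) := by
    have := le_min (show L (φ ^ N) - C - B ≤ lengthProd L (y ^ n) (h * φ ^ n) by linarith)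
      (show L (φ ^ N) - C - B ≤ lengthProd L (h * φ ^ N) (h * φ ^ n) by linarith)
    linarith
  have h₉ : L (φ ^ N) - C - B - 2 * D ≤ lengthProd L (y ^ N) (h * φ ^ N) := by
    have := le_min (show L (φ ^ N) - C - B - D ≤ lengthProd L (y ^ N) (y ^ n) by linarith) h₈
    linarith
  have h₁₀ : lengthProd L (y ^ N) (h * φ ^ N) =
    (L (y ^ N) + L (h * φ ^ N) - L ((y ^ N)⁻¹ * (h * φ ^ N))) / 2 := rfl
  rw [hlen] at h₁₀
  linarith

theorem finite_near_pair (hL : IsHypLength L D) {φ y : G} {K : ℝ} {N : ℕ}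
    (hfin : {h : G | L h < 2 * K ∧ L ((φ ^ N)⁻¹ * (h * φ ^ N)) < 2 * K}.Finite) :
    {h : G | L h < K ∧ L ((y ^ N)⁻¹ * (h * φ ^ N)) < K}.Finite := by
  rcases Set.eq_empty_or_nonempty {h : G | L h < K ∧ L ((y ^ N)⁻¹ * (h * φ ^ N)) < K} with
    h₀ | ⟨a, ha₁, ha₂⟩
  · rw [h₀]
    exact Set.finite_empty
  · refine (hfin.image (a * ·)).subset ?_
    rintro h ⟨h₁, h₂⟩
    refine ⟨a⁻¹ * h, ⟨?_, ?_⟩, by simp⟩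
    · have := hL.mul_le a⁻¹ h
      rw [hL.inv] at this
      linarith
    · have := hL.mul_le ((y ^ N)⁻¹ * (a * φ ^ N))⁻¹ ((y ^ N)⁻¹ * (h * φ ^ N))
      rw [hL.inv] at this
      have e : (φ ^ N)⁻¹ * (a⁻¹ * h * φ ^ N) =
        ((y ^ N)⁻¹ * (a * φ ^ N))⁻¹ * ((y ^ N)⁻¹ * (h * φ ^ N)) := by group
      rw [e]
      linarith

/-- A group that is not virtually cyclic and has a hyperbolic length function with a loxodromic
WPD element contains a free semigroup of rank two. -/
theorem exists_free_semigroup (hL : IsHypLength L D) (hNVC : NonVirtuallyCyclic G) {φ : G}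
    {τ : ℝ} (hτ : 0 < τ)
    (hlim : Filter.Tendsto (fun n : ℕ => L (φ ^ n) / n) Filter.atTop (nhds τ))
    (hwpd : ∀ K : ℝ, 0 < K →
      ∃ N : ℕ, {h : G | L h < K ∧ L ((φ ^ N)⁻¹ * (h * φ ^ N)) < K}.Finite) :
    ∃ f : Bool → G, ∀ l l' : List Bool, l.length = l'.length →
      (l.map f).prod = (l'.map f).prod → l = l' := by
  by_contra hfree
  have htop : Filter.Tendsto (fun n : ℕ => L (φ ^ n)) Filter.atTop Filter.atTop := by
    refine (hlim.pos_mul_atTop hτ tendsto_natCast_atTop_atTop).congr' ?_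
    filter_upwards [Filter.eventually_gt_atTop 0] with n hn
    have : (n : ℝ) ≠ 0 := by exact_mod_cast hn.ne'
    field_simp
  obtain ⟨C, hC⟩ := hL.exists_pow_prod_le hτ hlim
  have hC₀ : 0 ≤ C := (hL.prod_nonneg _ _).trans (hC 0 0)
  have hD := hL.const_nonneg
  have hφ := hL.nonneg φ
  have ends : ∀ x : G, (x = φ ∨ x = φ⁻¹) → ∀ (g : G) (R : ℝ),
      ∃ y, (y = φ ∨ y = φ⁻¹) ∧ ∃ n : ℕ, R < lengthProd L (y ^ n) (g * x ^ n) := by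
    intro x hx g R
    by_contra! hcon
    have hx' : x⁻¹ = φ ∨ x⁻¹ = φ⁻¹ := by rcases hx with rfl | rfl <;> simp
    refine hfree (hL.exists_injective_words (C := C) ?_ ?_ (hcon x hx) (hcon x⁻¹ hx'))
    · rcases hx with rfl | rfl
      · exact hC
      · intro i j
        rw [hL.prod_comm, inv_inv]
        exact hC j i
    · rcases hx with rfl | rfl
      · exact htop
      · simpa only [inv_pow, hL.inv] using htop
  set B := 2 * (C + D + L φ) + (C + 2 * D) with hB
  set K := 3 * B + 2 * C + 4 * D + 1 with hK
  obtain ⟨N, hN⟩ := hwpd (2 * K) (by positivity)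
  set T : Set G := {h | L h < K ∧ L ((φ ^ N)⁻¹ * (h * φ ^ N)) < K} ∪
    {h | L h < K ∧ L ((φ⁻¹ ^ N)⁻¹ * (h * φ ^ N)) < K} with hT
  have hTfin : T.Finite := (hL.finite_near_pair hN).union (hL.finite_near_pair hN)
  have hcover : ∀ g : G, ∃ k ∈ Subgroup.zpowers φ, k⁻¹ * g ∈ T := by
    intro g
    obtain ⟨k, hk, hkg⟩ := hL.exists_zpow_near hC g (ends φ (Or.inl rfl) g)
      (ends φ⁻¹ (Or.inr rfl) g)
    refine ⟨k, hk, ?_⟩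
    obtain ⟨y, hy, hyl⟩ := hL.exists_length_conj_pow_le hC hkg
      (ends φ (Or.inl rfl) (k⁻¹ * g)) N
    have h₁ : L (k⁻¹ * g) < K := by linarith
    have h₂ : L ((y ^ N)⁻¹ * (k⁻¹ * g * φ ^ N)) < K := by linarith
    rcases hy with rfl | rfl
    · exact Or.inl ⟨h₁, h₂⟩
    · exact Or.inr ⟨h₁, h₂⟩
  refine hNVC ⟨Subgroup.zpowers φ, ?_, inferInstance⟩
  have : Finite (G ⧸ Subgroup.zpowers φ) := by
    have hfin : ((fun h : G => (QuotientGroup.mk h⁻¹ : G ⧸ Subgroup.zpowers φ)) '' T).Finite :=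
      hTfin.image _
    refine Set.finite_univ_iff.mp (hfin.subset ?_)
    intro q _
    induction q using QuotientGroup.induction_on with
    | H g =>
      obtain ⟨k, hk, hkT⟩ := hcover g⁻¹
      refine ⟨_, hkT, ?_⟩
      rw [QuotientGroup.eq]
      simpa using hk
  exact Subgroup.finiteIndex_of_finite_quotient

end IsHypLength

/-! ### The four-point inequality in a hyperbolic space -/

namespace GeodesicSegment

theorem dist_initial_add_dist_terminal (γ : GeodesicSegment X) {p : X} (hp : p ∈ γ.seg) :
    dist γ.initial p + dist p γ.terminal = dist γ.initial γ.terminal := by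
  obtain ⟨t, ht, rfl⟩ := hp
  have h0 : (0 : ℝ) ∈ Set.Icc 0 γ.len := ⟨le_rfl, γ.len_nonneg⟩
  have h1 : γ.len ∈ Set.Icc 0 γ.len := ⟨γ.len_nonneg, le_rfl⟩
  rw [initial, terminal, γ.isom 0 h0 t ht, γ.isom t ht _ h1, γ.isom 0 h0 _ h1,
    abs_of_nonpos (by linarith [ht.1]), abs_of_nonpos (by linarith [ht.2]),
    abs_of_nonpos (by linarith [γ.len_nonneg])]
  ring

theorem initial_mem (γ : GeodesicSegment X) : γ.initial ∈ γ.seg :=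
  ⟨0, ⟨le_rfl, γ.len_nonneg⟩, rfl⟩

theorem terminal_mem (γ : GeodesicSegment X) : γ.terminal ∈ γ.seg :=
  ⟨γ.len, ⟨γ.len_nonneg, le_rfl⟩, rfl⟩

theorem isPreconnected_seg (γ : GeodesicSegment X) : IsPreconnected γ.seg := by
  refine isPreconnected_Icc.image _ (LipschitzOnWith.continuousOn (K := 1) ?_)
  refine LipschitzOnWith.of_dist_le_mul fun s hs t ht => ?_
  rw [γ.isom s hs t ht, Real.dist_eq]
  simp

end GeodesicSegment

/-- A point near `γ` almost realizes the triangle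
equality for the endpoints of `γ`. -/
theorem dist_add_dist_le_of_mem_cthickening {δ : ℝ} (hδ : 0 < δ) (γ : GeodesicSegment X) {p : X}
    (hp : p ∈ Metric.cthickening δ γ.seg) :
    dist γ.initial p + dist p γ.terminal ≤ dist γ.initial γ.terminal + 4 * δ := by
  obtain ⟨q, hq, hpq⟩ := Metric.mem_thickening_iff.mp
    (Metric.cthickening_subset_thickening' (by linarith : 0 < 2 * δ) (by linarith) _ hp)
  have h₁ := γ.dist_initial_add_dist_terminal hq
  have h₂ := dist_triangle γ.initial q p
  have h₃ := dist_triangle p q γ.terminal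
  rw [dist_comm q p] at h₂
  linarith

theorem gromovProd_le_dist (w : X) (γ : GeodesicSegment X) {p : X} (hp : p ∈ γ.seg) :
    gromovProd w γ.initial γ.terminal ≤ dist w p := by
  have h₁ := γ.dist_initial_add_dist_terminal hp
  have h₂ := dist_triangle γ.initial p w
  have h₃ := dist_triangle w p γ.terminal
  rw [dist_comm p w] at h₂
  unfold gromovProd
  linarith

/-- The distance to a geodesic is at most the Gromov product of its endpoints, up to an error. -/
theorem exists_dist_le_gromovProd {δ : ℝ} (hδ : 0 < δ) (hgeo : IsGeodesicSpace X)
    (hhyp : IsDeltaHyperbolic X δ) (w : X) (γ : GeodesicSegment X) :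
    ∃ p ∈ γ.seg, dist w p ≤ gromovProd w γ.initial γ.terminal + 4 * δ := by
  obtain ⟨α, hα₁, hα₂⟩ := hgeo γ.initial w
  obtain ⟨β, hβ₁, hβ₂⟩ := hgeo w γ.terminal
  have hcover := hhyp α β γ hα₁ (hα₂.trans hβ₁.symm) hβ₂
  rw [Metric.cthickening_union] at hcover
  obtain ⟨p, hp, hpα, hpβ⟩ := isPreconnected_closed_iff.mp γ.isPreconnected_seg _ _
    Metric.isClosed_cthickening Metric.isClosed_cthickening hcover
    ⟨γ.initial, γ.initial_mem, Metric.self_subset_cthickening _ (hα₁ ▸ α.initial_mem)⟩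
    ⟨γ.terminal, γ.terminal_mem, Metric.self_subset_cthickening _ (hβ₂ ▸ β.terminal_mem)⟩
  refine ⟨p, hp, ?_⟩
  have h₁ := dist_add_dist_le_of_mem_cthickening hδ α hpα
  have h₂ := dist_add_dist_le_of_mem_cthickening hδ β hpβ
  have h₃ := γ.dist_initial_add_dist_terminal hp
  rw [hα₁, hα₂, dist_comm p w] at h₁
  rw [hβ₁, hβ₂] at h₂
  unfold gromovProd
  linarith

theorem min_gromovProd_le {δ : ℝ} (hδ : 0 < δ) (hgeo : IsGeodesicSpace X)
    (hhyp : IsDeltaHyperbolic X δ) (w x y z : X) :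
    min (gromovProd w x y) (gromovProd w y z) ≤ gromovProd w x z + 6 * δ := by
  obtain ⟨γ, rfl, rfl⟩ := hgeo x z
  obtain ⟨α, hα₁, hα₂⟩ := hgeo γ.initial y
  obtain ⟨β, hβ₁, hβ₂⟩ := hgeo y γ.terminal
  have hcover := hhyp α β γ hα₁ (hα₂.trans hβ₁.symm) hβ₂
  obtain ⟨p, hp, hwp⟩ := exists_dist_le_gromovProd hδ hgeo hhyp w γ
  obtain ⟨q, hq, hpq⟩ := Metric.mem_thickening_iff.mp
    (Metric.cthickening_subset_thickening' (by linarith : 0 < 2 * δ) (by linarith) _ (hcover hp))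
  have hwq := dist_triangle w p q
  rcases hq with hq | hq
  · have := gromovProd_le_dist w α hq
    rw [hα₁, hα₂] at this
    exact (min_le_left _ _).trans (by linarith)
  · have := gromovProd_le_dist w β hq
    rw [hβ₁, hβ₂] at this
    exact (min_le_right _ _).trans (by linarith)

/-- Displacement of the basepoint is a hyperbolic length function. -/
theorem isHypLength_dist {δ : ℝ} (hδ : 0 < δ) (hgeo : IsGeodesicSpace X)
    (hhyp : IsDeltaHyperbolic X δ) {ρ : G → X → X} (hisom : ∀ g : G, Isometry (ρ g))
    (hmul : ∀ g h : G, ∀ x : X, ρ (g * h) x = ρ g (ρ h x)) (hone : ∀ x : X, ρ 1 x = x) (x0 : X) :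
    IsHypLength (fun g : G => dist x0 (ρ g x0)) (6 * δ) := by
  have htrans : ∀ g h : G, dist x0 (ρ (g⁻¹ * h) x0) = dist (ρ g x0) (ρ h x0) := by
    intro g h
    rw [← (hisom g).dist_eq, ← hmul, mul_inv_cancel_left]
  have hprod : ∀ g h : G, lengthProd (fun g : G => dist x0 (ρ g x0)) g h =
      gromovProd x0 (ρ g x0) (ρ h x0) := by
    intro g h
    simp only [lengthProd, gromovProd, htrans, dist_comm]
  refine ⟨by simp [hone], fun g => ?_, fun g h => ?_, fun g h k => ?_⟩
  · have := htrans g 1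
    rw [mul_one, hone, dist_comm (ρ g x0)] at this
    exact this
  · rw [hmul]
    refine (dist_triangle _ (ρ g x0) _).trans ?_
    rw [(hisom g).dist_eq]
  · simp only [hprod]
    exact min_gromovProd_le hδ hgeo hhyp _ _ _ _

/-! ### Growth of balls -/

section Growth

open scoped Pointwise

variable {S : Finset G}

theorem mem_ball_iff (hS : Subgroup.closure (S : Set G) = ⊤) {n : ℕ} {g : G} :
    g ∈ ball S (n : ℝ) ↔
      ∃ l : List G, l.length ≤ n ∧ (∀ x ∈ l, x ∈ S ∨ x⁻¹ ∈ S) ∧ l.prod = g := by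
  have hne : {n | ∃ l : List G, l.length = n ∧ (∀ x ∈ l, x ∈ S ∨ x⁻¹ ∈ S) ∧
      l.prod = g}.Nonempty := by
    obtain ⟨l, hl, hg⟩ := Submonoid.exists_list_of_mem_closure
      (s := (S : Set G) ∪ (S : Set G)⁻¹) (x := g)
      (by rw [← Subgroup.closure_toSubmonoid, hS]; trivial)
    exact ⟨_, l, rfl, by simpa using hl, hg⟩
  simp only [ball, Set.mem_ofPred_eq, Nat.cast_le]
  constructor
  · intro h
    obtain ⟨l, hl, hx, hg⟩ := Nat.sInf_mem hne
    exact ⟨l, hl.le.trans h, hx, hg⟩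
  · rintro ⟨l, hl, hx, hg⟩
    have h : wordLength S g ≤ l.length := Nat.sInf_le ⟨l, rfl, hx, hg⟩
    exact h.trans hl

theorem ball_add_subset (hS : Subgroup.closure (S : Set G) = ⊤) (m n : ℕ) :
    ball S ((m + n : ℕ) : ℝ) ⊆ ball S (m : ℝ) * ball S (n : ℝ) := by
  intro g hg
  obtain ⟨l, hl, hx, rfl⟩ := (mem_ball_iff hS).mp hg
  refine Set.mem_mul.mpr ⟨(l.take m).prod, (mem_ball_iff hS).mpr ⟨l.take m, ?_, ?_, rfl⟩,
    (l.drop m).prod, (mem_ball_iff hS).mpr ⟨l.drop m, ?_, ?_, rfl⟩,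
    List.prod_take_mul_prod_drop l m⟩
  · simp
  · exact fun x h => hx x (List.mem_of_mem_take h)
  · rw [List.length_drop]
    omega
  · exact fun x h => hx x (List.mem_of_mem_drop h)

theorem one_mem_ball (hS : Subgroup.closure (S : Set G) = ⊤) (n : ℕ) :
    (1 : G) ∈ ball S (n : ℝ) :=
  (mem_ball_iff hS).mpr ⟨[], by simp, by simp, rfl⟩

theorem finite_ball (hS : Subgroup.closure (S : Set G) = ⊤) (n : ℕ) :
    (ball S (n : ℝ)).Finite := by
  induction n with
  | zero =>
    refine (Set.finite_singleton (1 : G)).subset fun g hg => ?_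
    obtain ⟨l, hl, -, rfl⟩ := (mem_ball_iff hS).mp hg
    rw [List.length_eq_zero_iff.mp (Nat.le_zero.mp hl)]
    simp
  | succ n ih =>
    refine (ih.mul ?_).subset (ball_add_subset hS n 1)
    refine (((S : Set G).toFinite.union (S : Set G).toFinite.inv).union
      (Set.finite_singleton (1 : G))).subset fun g hg => ?_
    obtain ⟨l, hl, hx, rfl⟩ := (mem_ball_iff hS).mp hg
    match l, hl, hx with
    | [], _, _ => simp
    | [x], _, hx => simpa using Or.inr (hx x (by simp))

theorem ncard_ball_pos (hS : Subgroup.closure (S : Set G) = ⊤) (n : ℕ) :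
    0 < (ball S (n : ℝ)).ncard :=
  (Set.ncard_pos (finite_ball hS n)).mpr ⟨1, one_mem_ball hS n⟩

theorem subadditive_log_ncard_ball (hS : Subgroup.closure (S : Set G) = ⊤) :
    Subadditive fun n : ℕ => Real.log ((ball S (n : ℝ)).ncard : ℝ) := by
  intro m n
  have hm : (0 : ℝ) < (ball S (m : ℝ)).ncard := by exact_mod_cast ncard_ball_pos hS m
  have hn : (0 : ℝ) < (ball S (n : ℝ)).ncard := by exact_mod_cast ncard_ball_pos hS n
  have hmn : (0 : ℝ) < (ball S ((m + n : ℕ) : ℝ)).ncard := by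
    exact_mod_cast ncard_ball_pos hS (m + n)
  rw [← Real.log_mul hm.ne' hn.ne']
  refine Real.log_le_log hmn ?_
  have h₁ := Set.ncard_le_ncard (ball_add_subset hS m n)
    ((finite_ball hS m).mul (finite_ball hS n))
  have h₂ : (ball S (m : ℝ) * ball S (n : ℝ)).ncard ≤
      (ball S (m : ℝ)).ncard * (ball S (n : ℝ)).ncard := Set.natCard_mul_le
  exact_mod_cast h₁.trans h₂

theorem list_prod_mem_ball (hS : Subgroup.closure (S : Set G) = ⊤) {M : ℕ} (l : List G)
    (hl : ∀ x ∈ l, x ∈ ball S (M : ℝ)) : l.prod ∈ ball S ((l.length * M : ℕ) : ℝ) := by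
  induction l with
  | nil => exact one_mem_ball hS _
  | cons x l ih =>
    obtain ⟨k, hk, hkS, hkx⟩ := (mem_ball_iff hS).mp (hl x (by simp))
    obtain ⟨k', hk', hkS', hkl⟩ := (mem_ball_iff hS).mp (ih fun y hy => hl y (by simp [hy]))
    refine (mem_ball_iff hS).mpr ⟨k ++ k', ?_, ?_,
      by rw [List.prod_append, List.prod_cons, hkx, hkl]⟩
    · rw [List.length_append, List.length_cons, add_mul, one_mul]
      omega
    · intro y hy
      rcases List.mem_append.mp hy with h | h
      · exact hkS y h
      · exact hkS' y h

/-- A free semigroup of rank two forces exponentially many elements. -/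
theorem exists_two_pow_le_ncard_ball (hS : Subgroup.closure (S : Set G) = ⊤) {f : Bool → G}
    (hf : ∀ l l' : List Bool, l.length = l'.length →
      (l.map f).prod = (l'.map f).prod → l = l') :
    ∃ M : ℕ, 0 < M ∧ ∀ n : ℕ, 2 ^ n ≤ (ball S ((n * M : ℕ) : ℝ)).ncard := by
  set M := max (max (wordLength S (f true)) (wordLength S (f false))) 1 with hM
  have hfM : ∀ b, f b ∈ ball S (M : ℝ) := by
    rintro (_ | _)
    · exact (Nat.cast_le (α := ℝ)).mpr ((le_max_right _ _).trans (le_max_left _ _))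
    · exact (Nat.cast_le (α := ℝ)).mpr ((le_max_left _ _).trans (le_max_left _ _))
  refine ⟨M, by omega, fun n => ?_⟩
  have hinj : Function.Injective fun v : List.Vector Bool n => (v.toList.map f).prod := by
    intro v w h
    exact List.Vector.toList_injective (hf _ _ (by simp) h)
  have hsub : Set.range (fun v : List.Vector Bool n => (v.toList.map f).prod) ⊆
      ball S ((n * M : ℕ) : ℝ) := by
    rintro _ ⟨v, rfl⟩
    have := list_prod_mem_ball hS (M := M) (v.toList.map f) (fun x hx => by
      obtain ⟨b, -, rfl⟩ := List.mem_map.mp hx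
      exact hfM b)
    rwa [List.length_map, List.Vector.toList_length] at this
  have hcard := Set.ncard_le_ncard hsub (finite_ball hS _)
  rw [← Set.image_univ, Set.ncard_image_of_injective _ hinj, Set.ncard_univ,
    Nat.card_eq_fintype_card, card_vector, Fintype.card_bool] at hcard
  exact hcard

end Growth

/-- If `u n / n` converges to a positive limit then `u` grows by a definite linear amount between
`0.9 * n` and `n`. -/
theorem exists_sub_le_of_tendsto {u : ℕ → ℝ} {ω : ℝ} (hω : 0 < ω)
    (hu : Filter.Tendsto (fun n => u n / n) Filter.atTop (nhds ω)) :
    ∃ N : ℕ, ∀ n, N ≤ n → u ⌊(0.9 : ℝ) * n⌋₊ - u n ≤ -(ω / 20 * n) := by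
  obtain ⟨N, hN⟩ := Filter.eventually_atTop.mp
    (hu.eventually (Ioo_mem_nhds (show ω - ω / 100 < ω by linarith)
      (show ω < ω + ω / 100 by linarith)))
  refine ⟨2 * N + 2, fun n hn => ?_⟩
  have hn₁ : (2 * N + 2 : ℝ) ≤ n := by exact_mod_cast hn
  have hN₀ : (0 : ℝ) ≤ N := N.cast_nonneg
  set k := ⌊(0.9 : ℝ) * n⌋₊ with hk
  have hkn : (k : ℝ) ≤ 0.9 * n := Nat.floor_le (by linarith)
  have hk₁ : N + 1 ≤ k := Nat.le_floor (by push_cast; linarith)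
  have hk₀ : (0 : ℝ) < k := by exact_mod_cast (by omega : 0 < k)
  have h₁ := (hN k (by omega)).2
  have h₂ := (hN n (by omega)).1
  rw [div_lt_iff₀ hk₀] at h₁
  rw [lt_div_iff₀ (by linarith)] at h₂
  have h₃ : (ω + ω / 100) * k ≤ (ω + ω / 100) * (0.9 * n) :=
    mul_le_mul_of_nonneg_left hkn (by linarith)
  have h₄ : 0 < ω * n := mul_pos hω (by linarith)
  linarith

/-- `G` has exponential growth, and balls of radius `0.9 n` are exponentially smaller
than balls of radius `n` (Fact 4.1). -/
theorem exponential_growth {G : Type*} [Group G] {X : Type*} [MetricSpace X]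
    (S : Finset G) (hSgen : Subgroup.closure (S : Set G) = ⊤)
    (hNVC : NonVirtuallyCyclic G)
    (δ : ℝ) (hδ : 0 < δ) (hgeo : IsGeodesicSpace X) (hhyp : IsDeltaHyperbolic X δ)
    (ρ : G → X → X) (hisom : ∀ g : G, Isometry (ρ g))
    (hmul : ∀ g h : G, ∀ x : X, ρ (g * h) x = ρ g (ρ h x)) (hone : ∀ x : X, ρ 1 x = x)
    (x0 : X) (φ : G)
    (hlox : IsLoxodromic ρ x0 φ) (hwpd : HasWPD ρ x0 φ) :
    0 < Filter.liminf
        (fun n : ℕ => Real.log ((ball S (n:ℝ)).ncard : ℝ) / (n : ℝ)) Filter.atTop ∧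
    ∃ lam : ℝ, 1 < lam ∧ ∃ N : ℕ, ∀ n : ℕ, N ≤ n →
      ((ball S ((⌊(0.9:ℝ) * (n:ℝ)⌋₊ : ℕ) : ℝ)).ncard : ℝ) / ((ball S (n:ℝ)).ncard : ℝ)
        ≤ (lam ^ n)⁻¹ := by
  obtain ⟨τ, hτ, hlim⟩ := hlox
  have hL := isHypLength_dist hδ hgeo hhyp hisom hmul hone x0
  obtain ⟨f, hf⟩ := hL.exists_free_semigroup hNVC hτ hlim (by
    intro K hK
    obtain ⟨N, -, hfin, -⟩ := hwpd K hK
    refine ⟨N, hfin.subset ?_⟩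
    rintro h ⟨h₁, h₂⟩
    refine ⟨h₁, ?_⟩
    rwa [← (hisom (φ ^ N)).dist_eq, ← hmul, mul_inv_cancel_left, hmul h] at h₂)
  obtain ⟨M, hM, hcard⟩ := exists_two_pow_le_ncard_ball hSgen hf
  set u : ℕ → ℝ := fun n => Real.log ((ball S (n : ℝ)).ncard : ℝ) with hu
  have hsub : Subadditive u := subadditive_log_ncard_ball hSgen
  have hbdd : BddBelow (Set.range fun n => u n / n) := by
    refine ⟨0, ?_⟩
    rintro _ ⟨n, rfl⟩
    exact div_nonneg (Real.log_natCast_nonneg _) n.cast_nonneg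
  have htend := hsub.tendsto_lim hbdd
  have hMpos : (0 : ℝ) < M := by exact_mod_cast hM
  have hω : 0 < hsub.lim := by
    refine (div_pos (Real.log_pos one_lt_two) hMpos).trans_le (ge_of_tendsto
      (htend.comp (Filter.tendsto_id.atTop_mul_const' hM)) ?_)
    filter_upwards [Filter.eventually_gt_atTop 0] with n hn
    have hn₀ : (0 : ℝ) < n := by exact_mod_cast hn
    have h₁ : (n : ℝ) * Real.log 2 ≤ u (n * M) := by
      rw [← Real.log_pow]
      exact Real.log_le_log (by positivity) (by exact_mod_cast hcard n)
    simp only [Function.comp_apply, id_eq, Nat.cast_mul]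
    rw [div_le_div_iff₀ hMpos (by positivity)]
    nlinarith
  refine ⟨htend.liminf_eq ▸ hω, Real.exp (hsub.lim / 20), Real.one_lt_exp_iff.mpr (by linarith), ?_⟩
  obtain ⟨N, hN⟩ := exists_sub_le_of_tendsto hω htend
  refine ⟨N, fun n hn => ?_⟩
  have hpos : ∀ k : ℕ, (0 : ℝ) < (ball S (k : ℝ)).ncard := fun k => by
    exact_mod_cast ncard_ball_pos hSgen k
  rw [← Real.exp_nat_mul, ← Real.exp_neg, ← Real.log_le_iff_le_exp (div_pos (hpos _) (hpos _)),
    Real.log_div (hpos _).ne' (hpos _).ne', mul_comm (n : ℝ) (hsub.lim / 20)]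
  exact hN n hn

end AcylCount
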